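/- For positive semidefinite matrices ρ, σ with trace 1 such that the image of ρ is contained in the image of σ, the relative entropy D(ρ‖σ) = Tr(ρ log ρ) − Tr(ρ log σ) is bounded above by the max relative entropy D_max(ρ‖σ) = log min{t ∈ ℝ : ρ ≤ t·σ}. -/

import Mathlib

open Matrix ComplexOrder

/-- Matrix logarithm on the support of a Hermitian matrix: apply `Real.log`
(with `Real.log 0 = 0`) to the eigenvalues in the eigenbasis. -/
noncomputable def mlog {n : Type*} [Fintype n] [DecidableEq n]
    (ρ : Matrix n n ℂ) (h : ρ.IsHermitian) : Matrix n n ℂ :=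
  (h.eigenvectorUnitary : Matrix n n ℂ) *
    Matrix.diagonal (fun i => (Real.log (h.eigenvalues i) : ℂ)) *
    (h.eigenvectorUnitary : Matrix n n ℂ)ᴴ

/-- Max relative entropy `D_max(ρ‖σ) = log min {t : ρ ≤ t σ}` (Loewner order). -/
noncomputable def Dmax {n : Type*} [Fintype n] [DecidableEq n]
    (ρ σ : Matrix n n ℂ) : ℝ :=
  Real.log (sInf {t : ℝ | (t • σ - ρ).PosSemidef})

lemma quad_diag {n : Type*} [Fintype n] [DecidableEq n] (V : Matrix n n ℂ) (d : n → ℝ)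
    (x : n → ℂ) :
    star x ⬝ᵥ ((V * Matrix.diagonal (fun i => (d i : ℂ)) * Vᴴ) *ᵥ x)
      = ((∑ j, d j * ‖(Vᴴ *ᵥ x) j‖ ^ 2 : ℝ) : ℂ) := by
  rw [← Matrix.mulVec_mulVec, ← Matrix.mulVec_mulVec, Matrix.dotProduct_mulVec]
  have h : star x ᵥ* V = star (Vᴴ *ᵥ x) := by
    rw [Matrix.star_mulVec, Matrix.conjTranspose_conjTranspose]
  rw [h]
  simp only [dotProduct, Matrix.mulVec_diagonal, Pi.star_apply]
  push_cast
  refine Finset.sum_congr rfl fun j _ => ?_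
  rw [← Complex.conj_mul']
  simp only [RCLike.star_def]
  ring

lemma spec_eq {n : Type*} [Fintype n] [DecidableEq n] (A : Matrix n n ℂ) (h : A.IsHermitian) :
    A = (h.eigenvectorUnitary : Matrix n n ℂ) *
      Matrix.diagonal (fun i => (h.eigenvalues i : ℂ)) *
      (h.eigenvectorUnitary : Matrix n n ℂ)ᴴ := by
  conv_lhs => rw [h.spectral_theorem]
  rfl

lemma trace_diag {n : Type*} [Fintype n] [DecidableEq n] (U M : Matrix n n ℂ) (p : n → ℝ) :
    ((U * Matrix.diagonal (fun i => (p i : ℂ)) * Uᴴ) * M).trace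
      = ∑ i, (p i : ℂ) * (star (fun k => U k i) ⬝ᵥ (M *ᵥ (fun k => U k i))) := by
  rw [Matrix.mul_assoc, Matrix.mul_assoc, Matrix.trace_mul_comm, Matrix.mul_assoc,
    Matrix.trace]
  refine Finset.sum_congr rfl fun i _ => ?_
  rw [Matrix.diag_apply, Matrix.diagonal_mul, Matrix.mul_assoc]
  rfl

lemma jensen_log {n : Type*} [Fintype n] (s b : n → ℝ) (hs : ∀ j, 0 ≤ s j)
    (hw : ∑ j, s j ^ 2 * b j = 1) (hb : ∀ j, 0 ≤ b j) (c : ℝ) (hc : c = ∑ j, s j * b j)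
    (hc0 : 0 < c) :
    -∑ j, Real.log (s j) * (s j ^ 2 * b j) ≤ Real.log c := by
  have key : ∀ j, -(Real.log (s j) * (s j ^ 2 * b j)) - Real.log c * (s j ^ 2 * b j)
      ≤ s j * b j / c - s j ^ 2 * b j := by
    intro j
    rcases (hs j).eq_or_lt with h | h
    · simp [← h]
    · have h1 := Real.log_le_sub_one_of_pos (x := (s j * c)⁻¹) (by positivity)
      rw [Real.log_inv, Real.log_mul h.ne' hc0.ne'] at h1
      have h2 := mul_le_mul_of_nonneg_right h1
        (show 0 ≤ s j ^ 2 * b j from mul_nonneg (by positivity) (hb j))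
      have h3 : ((s j * c)⁻¹ - 1) * (s j ^ 2 * b j) = s j * b j / c - s j ^ 2 * b j := by
        field_simp
      linarith
  have h := Finset.sum_le_sum fun j (_ : j ∈ Finset.univ) => key j
  rw [Finset.sum_sub_distrib, Finset.sum_sub_distrib, ← Finset.mul_sum, ← Finset.sum_div, ← hc,
    hw, Finset.sum_neg_distrib, div_self hc0.ne'] at h
  linarith

/-- the relative entropy is bounded by the max relative entropy. -/
theorem relEntropy_le_Dmax {n : Type*} [Fintype n] [DecidableEq n]
    (ρ σ : Matrix n n ℂ) (hρ : ρ.PosSemidef) (hσ : σ.PosSemidef)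
    (hρ1 : ρ.trace = 1) (hσ1 : σ.trace = 1)
    (him : LinearMap.range ρ.mulVecLin ≤ LinearMap.range σ.mulVecLin) :
    (ρ * mlog ρ hρ.1).trace.re - (ρ * mlog σ hσ.1).trace.re ≤ Dmax ρ σ := by
  have hρs := spec_eq ρ hρ.1
  have hσs := spec_eq σ hσ.1
  unfold mlog Dmax
  have hp := hρ.eigenvalues_nonneg
  have hs := hσ.eigenvalues_nonneg
  have hU : (hρ.1.eigenvectorUnitary : Matrix n n ℂ)ᴴ * hρ.1.eigenvectorUnitary = 1 :=
    Unitary.coe_star_mul_self hρ.1.eigenvectorUnitary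
  have hV : (hσ.1.eigenvectorUnitary : Matrix n n ℂ)ᴴ * hσ.1.eigenvectorUnitary = 1 :=
    Unitary.coe_star_mul_self hσ.1.eigenvectorUnitary
  have hV' : (hσ.1.eigenvectorUnitary : Matrix n n ℂ) * (hσ.1.eigenvectorUnitary : Matrix n n ℂ)ᴴ = 1 :=
    Unitary.coe_mul_star_self hσ.1.eigenvectorUnitary
  have hσH : σᴴ = σ := hσ.1
  generalize (hρ.1.eigenvectorUnitary : Matrix n n ℂ) = U at *
  generalize (hσ.1.eigenvectorUnitary : Matrix n n ℂ) = V at *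
  generalize hρ.1.eigenvalues = p at *
  generalize hσ.1.eigenvalues = s at *
  -- columns
  have hUx : ∀ (x : n → ℂ) i, (Uᴴ *ᵥ x) i = star (fun k => U k i) ⬝ᵥ x := fun x i => rfl
  have hUcol : ∀ i, Uᴴ *ᵥ (fun k => U k i) = Pi.single i 1 := by
    intro i
    have : (fun k => U k i) = U *ᵥ Pi.single i 1 := by
      ext k; simp
    rw [this, Matrix.mulVec_mulVec, hU, Matrix.one_mulVec]
  have hρu : ∀ i, ρ *ᵥ (fun k => U k i) = (p i : ℂ) • (fun k => U k i) := by
    intro i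
    rw [hρs, ← Matrix.mulVec_mulVec, ← Matrix.mulVec_mulVec, hUcol]
    ext k
    simp [Matrix.mulVec, dotProduct, Matrix.diagonal_apply, Pi.single_apply, mul_comm]
  have hy : ∀ i, ∃ y : n → ℂ, 0 < p i → σ *ᵥ y = fun k => U k i := by
    intro i
    by_cases h : 0 < p i
    · have : (fun k => U k i) ∈ LinearMap.range ρ.mulVecLin := by
        refine ⟨((p i : ℂ)⁻¹) • (fun k => U k i), ?_⟩
        rw [Matrix.mulVecLin_apply, Matrix.mulVec_smul, hρu, smul_smul, inv_mul_cancel₀,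
          one_smul]
        exact_mod_cast h.ne'
      obtain ⟨y, hy⟩ := him this
      exact ⟨y, fun _ => hy⟩
    · exact ⟨0, fun h' => absurd h' h⟩
  choose y hy using hy
  have hqρ := fun x => quad_diag U p x
  have hqσ := fun x => quad_diag V s x
  rw [← hρs] at hqρ
  rw [← hσs] at hqσ
  have hVσ : ∀ y j, (Vᴴ *ᵥ (σ *ᵥ y)) j = s j * (Vᴴ *ᵥ y) j := by
    intro y j
    conv_lhs => rw [hσs]
    rw [← Matrix.mulVec_mulVec, ← Matrix.mulVec_mulVec, Matrix.mulVec_mulVec, hV,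
      Matrix.one_mulVec, Matrix.mulVec_diagonal]
  have hpsum : ∑ i, p i = 1 := by
    have h := trace_diag U 1 p
    rw [← hρs, mul_one, hρ1] at h
    simp only [Matrix.one_mulVec, ← hUx, hUcol, Pi.single_eq_same, mul_one] at h
    exact_mod_cast h.symm
  have e1 : (ρ * (U * Matrix.diagonal (fun i => (Real.log (p i) : ℂ)) * Uᴴ)).trace.re
      = ∑ i, p i * Real.log (p i) := by
    conv_lhs => rw [hρs]
    rw [trace_diag]
    simp only [quad_diag, ← Complex.ofReal_mul, ← Complex.ofReal_sum, Complex.ofReal_re]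
    refine Finset.sum_congr rfl fun i _ => ?_
    rw [hUcol]
    simp [Pi.single_apply, apply_ite]
  have e2 : (ρ * (V * Matrix.diagonal (fun i => (Real.log (s i) : ℂ)) * Vᴴ)).trace.re
      = ∑ i, p i * ∑ j, Real.log (s j) * ‖(Vᴴ *ᵥ (fun k => U k i)) j‖ ^ 2 := by
    conv_lhs => rw [hρs]
    rw [trace_diag]
    simp only [quad_diag, ← Complex.ofReal_mul, ← Complex.ofReal_sum, Complex.ofReal_re]
  rw [e1, e2]
  -- star u_i ⬝ x in terms of y
  have hin : ∀ i, 0 < p i → ∀ x, (Uᴴ *ᵥ x) i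
      = ∑ j, (s j : ℂ) * (star ((Vᴴ *ᵥ y i) j) * (Vᴴ *ᵥ x) j) := by
    intro i hi x
    have hx : x = V *ᵥ (Vᴴ *ᵥ x) := by rw [Matrix.mulVec_mulVec, hV', Matrix.one_mulVec]
    rw [hUx, ← hy i hi]
    conv_lhs => rw [hx]
    rw [Matrix.dotProduct_mulVec]
    have : star (σ *ᵥ y i) ᵥ* V = star (Vᴴ *ᵥ (σ *ᵥ y i)) := by
      rw [Matrix.star_mulVec (Vᴴ), Matrix.conjTranspose_conjTranspose]
    rw [this]
    refine Finset.sum_congr rfl fun j _ => ?_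
    rw [Pi.star_apply, hVσ]
    simp
    ring
  set c : n → ℝ := fun i => ∑ j, s j * ‖(Vᴴ *ᵥ y i) j‖ ^ 2 with hc
  have hc_nonneg : ∀ i, 0 ≤ c i := fun i =>
    Finset.sum_nonneg fun j _ => mul_nonneg (hs j) (by positivity)
  have hUy : ∀ i, 0 < p i → (Uᴴ *ᵥ y i) i = c i := by
    intro i hi
    rw [hin i hi, hc]
    push_cast
    refine Finset.sum_congr rfl fun j _ => ?_
    rw [← Complex.conj_mul']
    rfl
  have hCS : ∀ i, 0 < p i → ∀ x, ‖(Uᴴ *ᵥ x) i‖ ^ 2 ≤ c i * ∑ j, s j * ‖(Vᴴ *ᵥ x) j‖ ^ 2 := by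
    intro i hi x
    rw [hin i hi]
    have h1 : ‖∑ j, (s j : ℂ) * (star ((Vᴴ *ᵥ y i) j) * (Vᴴ *ᵥ x) j)‖
        ≤ ∑ j, s j * (‖(Vᴴ *ᵥ y i) j‖ * ‖(Vᴴ *ᵥ x) j‖) := by
      refine (norm_sum_le _ _).trans (le_of_eq ?_)
      refine Finset.sum_congr rfl fun j _ => ?_
      rw [norm_mul, norm_mul, norm_star, Complex.norm_real, Real.norm_of_nonneg (hs j)]
    refine (pow_le_pow_left₀ (norm_nonneg _) h1 2).trans ?_
    refine Finset.sum_sq_le_sum_mul_sum_of_sq_eq_mul _ (fun j _ => mul_nonneg (hs j) (by positivity))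
      (fun j _ => mul_nonneg (hs j) (by positivity)) (fun j _ => by ring)
  have hquad : ∀ (t : ℝ) x, star x ⬝ᵥ ((t • σ - ρ) *ᵥ x)
      = ((t * ∑ j, s j * ‖(Vᴴ *ᵥ x) j‖ ^ 2 - ∑ j, p j * ‖(Uᴴ *ᵥ x) j‖ ^ 2 : ℝ) : ℂ) := by
    intro t x
    rw [Matrix.sub_mulVec, dotProduct_sub, Matrix.smul_mulVec, dotProduct_smul, hqρ, hqσ]
    rw [Complex.ofReal_sub, Complex.ofReal_mul, Complex.real_smul]
  have hne : {t : ℝ | (t • σ - ρ).PosSemidef}.Nonempty := by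
    refine ⟨∑ i, p i * c i, ?_⟩
    refine Matrix.PosSemidef.of_dotProduct_mulVec_nonneg ?_ fun x => ?_
    · have hρH : ρᴴ = ρ := hρ.1
      rw [Matrix.IsHermitian, Matrix.conjTranspose_sub, Matrix.conjTranspose_smul, hσH, hρH]
      simp
    · rw [hquad, Complex.zero_le_real, sub_nonneg, Finset.sum_mul]
      refine Finset.sum_le_sum fun i _ => ?_
      rcases (hp i).eq_or_lt with h | h
      · have h' : p i = 0 := h.symm
        simp [h']
      · rw [mul_assoc]
        exact mul_le_mul_of_nonneg_left (hCS i h x) h.le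
  have main : ∀ t ∈ {t : ℝ | (t • σ - ρ).PosSemidef},
      0 < t ∧ ∑ i, p i * Real.log (p i)
        - ∑ i, p i * ∑ j, Real.log (s j) * ‖(Vᴴ *ᵥ (fun k => U k i)) j‖ ^ 2 ≤ Real.log t := by
    intro t ht
    have hpt : ∀ i, 0 < p i → 0 < c i ∧ p i * c i ≤ t := by
      intro i hi
      have h0 := ht.dotProduct_mulVec_nonneg (y i)
      rw [hquad, Complex.zero_le_real, sub_nonneg] at h0
      have h1 := Finset.single_le_sum (f := fun j => p j * ‖(Uᴴ *ᵥ y i) j‖ ^ 2)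
        (fun j _ => mul_nonneg (hp j) (by positivity)) (Finset.mem_univ i)
      have h2 := h1.trans h0
      simp only [hUy i hi, Complex.norm_real, Real.norm_of_nonneg (hc_nonneg i)] at h2
      have h3 : 0 < c i := by
        refine (hc_nonneg i).lt_of_ne fun h => ?_
        have := hCS i hi (fun k => U k i)
        rw [← h, hUcol] at this
        norm_num at this
      refine ⟨h3, ?_⟩
      have h4 : p i * c i * c i ≤ t * c i := by
        calc p i * c i * c i = p i * c i ^ 2 := by ring
          _ ≤ t * c i := h2
      exact le_of_mul_le_mul_right h4 h3
    have ht0 : 0 < t := by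
      obtain ⟨i, hi⟩ : ∃ i, 0 < p i := by
        by_contra! h
        have := Finset.sum_nonpos fun i (_ : i ∈ Finset.univ) => h i
        linarith
      obtain ⟨h1, h2⟩ := hpt i hi
      exact (mul_pos hi h1).trans_le h2
    refine ⟨ht0, ?_⟩
    rw [← Finset.sum_sub_distrib, ← one_mul (Real.log t), ← hpsum, Finset.sum_mul]
    refine Finset.sum_le_sum fun i _ => ?_
    rcases (hp i).eq_or_lt with h | h
    · have h' : p i = 0 := h.symm
      simp [h']
    · rw [← mul_sub]
      refine mul_le_mul_of_nonneg_left ?_ h.le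
      obtain ⟨h1, h2⟩ := hpt i h
      have hw : ∀ j, ‖(Vᴴ *ᵥ (fun k => U k i)) j‖ ^ 2 = s j ^ 2 * ‖(Vᴴ *ᵥ y i) j‖ ^ 2 := by
        intro j
        rw [← hy i h, hVσ, norm_mul, mul_pow, Complex.norm_real, Real.norm_of_nonneg (hs j)]
      have hw1 : ∑ j, s j ^ 2 * ‖(Vᴴ *ᵥ y i) j‖ ^ 2 = 1 := by
        simp only [← hw]
        have h5 := quad_diag V (fun _ => 1) (fun k => U k i)
        have h6 : (Matrix.diagonal fun _ : n => (((1 : ℝ)) : ℂ)) = 1 := by simp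
        rw [h6, mul_one, hV', Matrix.one_mulVec, ← hUx, hUcol, Pi.single_eq_same] at h5
        simp only [one_mul] at h5
        exact_mod_cast h5.symm
      have hj := jensen_log s (fun j => ‖(Vᴴ *ᵥ y i) j‖ ^ 2) hs hw1 (fun j => by positivity)
        (c i) rfl h1
      have hl := Real.log_le_log (mul_pos h h1) h2
      rw [Real.log_mul h.ne' h1.ne'] at hl
      simp only [hw]
      linarith
  have hexp := le_csInf hne fun t ht =>
    (Real.le_log_iff_exp_le (main t ht).1).1 (main t ht).2
  exact (Real.le_log_iff_exp_le ((Real.exp_pos _).trans_le hexp)).2 hexp
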